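/- arXiv:2504.13966 — 8 statements merged into one kernel-verified Lean document; each statement's English description precedes it below -/
import Mathlib

section
/- Let F be a binary hypothesis class with VCdim(F) = 1 run with Algorithm 2 with abstention threshold α and reference function f, and let γ_t = |Γ(S_t, F, f)| where S_t is the labeled data set after round t. Then for every t ∈ {1,…,T}: γ_t ≤ γ_{t−1} − α·1{a misclassification occurs at time t} + 1. -/
/-!
STATEMENT 3: For a binary hypothesis class `F` with `VCdim(F) = 1`, running
Algorithm 2 with abstention threshold `α` and reference function `f`, and
setting `γ_t = |Γ(S_t, F, f)|` for the labeled data set `S_t` after round `t`,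
for every `t ∈ {1,…,T}` we have
`γ_t ≤ γ_{t−1} − α·1{a misclassification occurs at time t} + 1`.
-/

open scoped Classical

namespace Stmt3

variable {X : Type*}

/-- Disagreement region of a class of hypotheses. -/
def DIS (G : Set (X → Bool)) : Set X :=
  {x | ∃ g ∈ G, ∃ h ∈ G, g x ≠ h x}

/-- The common label of all hypotheses of `G` at `x` (when all agree). -/
noncomputable def agreedLabel (G : Set (X → Bool)) (x : X) : Bool :=
  if ∀ h ∈ G, h x = true then true else false

/-- `F` shatters the finite set `s`. -/
def ShattersFinset (F : Set (X → Bool)) (s : Finset X) : Prop :=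
  ∀ y : X → Bool, ∃ h ∈ F, ∀ x ∈ s, h x = y x

/-- `VCdim(F) = d`: some set of size `d` is shattered and no set of size `d+1` is. -/
def VCdimEq (F : Set (X → Bool)) (d : ℕ) : Prop :=
  (∃ s : Finset X, s.card = d ∧ ShattersFinset F s) ∧
    ∀ s : Finset X, s.card = d + 1 → ¬ShattersFinset F s

/-- Restriction of a class to a set of labeled examples (the consistent hypotheses). -/
def restrictC (F : Set (X → Bool)) (S : Set (X × Bool)) : Set (X → Bool) :=
  {h | h ∈ F ∧ ∀ p ∈ S, h p.1 = p.2}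

/-- Restriction of a class to one additional labeled example: `G^{x→b}`. -/
def restrictPoint (G : Set (X → Bool)) (x : X) (b : Bool) : Set (X → Bool) :=
  {h | h ∈ G ∧ h x = b}

/-- The labeled examples of `S` disagreeing with the reference function `f`. -/
def Sref (f : X → Bool) (S : Set (X × Bool)) : Set (X × Bool) :=
  {p ∈ S | f p.1 ≠ p.2}

/-- The leave-one-out disagreement estimate `Γ(S, F, f)`. -/
def Gamma (S : Set (X × Bool)) (F : Set (X → Bool)) (f : X → Bool) : Set X :=
  {x | ∃ y, (x, y) ∈ S ∧ x ∈ DIS (restrictC F (Sref f S \ {(x, y)}))}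
/-- The learner of Algorithm 2 with reference function `f` and abstention
threshold `α`: predict the consistent label outside the disagreement region of
the current version space; inside it, predict `f(x̂)` if
`a₀ = |Γ(S, F^{x̂→f(x̂)}, f)| ≥ α` and abstain otherwise. -/
noncomputable def alg2Learner (F : Set (X → Bool)) (f : X → Bool) (α : ℝ) :
    List (X × Bool) → X → Option Bool := fun S x =>
  let Sset : Set (X × Bool) := {p | p ∈ S}
  let V := restrictC F Sset
  if x ∉ DIS V then some (agreedLabel V x)
  else if α ≤ ((Gamma Sset (restrictPoint F x (f x)) f).ncard : ℝ) then some (f x)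
  else none
/-- The labeled history after `t` rounds of an arbitrary (possibly adversarial)
stream `xh` of points labeled by the target `fstar`: `S_t`. -/
def histS (fstar : X → Bool) (xh : ℕ → X) : ℕ → List (X × Bool)
  | 0 => []
  | t + 1 => histS fstar xh t ++ [(xh t, fstar (xh t))]

theorem DIS_mono {G H : Set (X → Bool)} (h : G ⊆ H) : DIS G ⊆ DIS H :=
  fun _ ⟨g, hg, k, hk, hne⟩ => ⟨g, h hg, k, h hk, hne⟩

theorem exists_apply_eq_of_mem_DIS {G : Set (X → Bool)} {x : X} (h : x ∈ DIS G) (b : Bool) :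
    ∃ g ∈ G, g x = b := by
  obtain ⟨g, hg, k, hk, hne⟩ := h
  by_cases hb : g x = b
  · exact ⟨g, hg, hb⟩
  · exact ⟨k, hk, (Bool.eq_not.2 hne.symm).trans (Bool.not_eq.2 hb)⟩

theorem restrictC_mono {F G : Set (X → Bool)} {S S' : Set (X × Bool)} (hF : F ⊆ G)
    (hS : S ⊆ S') : restrictC F S' ⊆ restrictC G S :=
  fun _ h => ⟨hF h.1, fun p hp => h.2 p (hS hp)⟩

theorem restrictPoint_subset (F : Set (X → Bool)) (x : X) (b : Bool) : restrictPoint F x b ⊆ F :=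
  fun _ h => h.1

theorem Gamma_mono_left {F G : Set (X → Bool)} (h : F ⊆ G) (S : Set (X × Bool)) (f : X → Bool) :
    Gamma S F f ⊆ Gamma S G f :=
  fun _ ⟨y, hy, hd⟩ => ⟨y, hy, DIS_mono (restrictC_mono h subset_rfl) hd⟩

theorem finite_Gamma {S : Set (X × Bool)} (hS : S.Finite) (F : Set (X → Bool)) (f : X → Bool) :
    (Gamma S F f).Finite :=
  (hS.image Prod.fst).subset fun x ⟨y, hy, _⟩ => ⟨(x, y), hy, rfl⟩

theorem Gamma_insert_diff_subset (S : Set (X × Bool)) (F : Set (X → Bool)) (f : X → Bool)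
    (x : X) (y : Bool) : Gamma (insert (x, y) S) F f \ {x} ⊆ Gamma S F f := by
  rintro z ⟨⟨b, hb, hd⟩, hz⟩
  have hbS : (z, b) ∈ S := hb.resolve_left fun h => hz (congrArg Prod.fst h)
  refine ⟨b, hbS, DIS_mono (restrictC_mono subset_rfl ?_) hd⟩
  exact fun p hp => ⟨⟨Or.inr hp.1.1, hp.1.2⟩, hp.2⟩

theorem ncard_Gamma_insert_le (S : Set (X × Bool)) (F : Set (X → Bool))
    (f : X → Bool) (x : X) (y : Bool) :
    (Gamma (insert (x, y) S) F f).ncard ≤ (Gamma (insert (x, y) S) F f \ {x}).ncard + 1 := by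
  have h := Set.ncard_le_ncard_sdiff_add_ncard (Gamma (insert (x, y) S) F f) {x}
  simpa using h

/-- In VC dimension at most one, a point cannot be in the leave-one-out disagreement estimate for
both labels of another point. -/
theorem disjoint_Gamma_insert_diff {F : Set (X → Bool)}
    (hVC : ∀ s : Finset X, s.card = 2 → ¬ShattersFinset F s) {f : X → Bool}
    {S : Set (X × Bool)} {x : X} {y : Bool} (hy : f x ≠ y) :
    Disjoint (Gamma (insert (x, y) S) F f \ {x}) (Gamma S (restrictPoint F x (f x)) f) := by
  rw [Set.disjoint_left]
  rintro z ⟨⟨b, hb, hd⟩, hz : z ≠ x⟩ ⟨c, hc, hd'⟩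
  have hne : (x, y) ≠ (z, b) := fun h => hz (congrArg Prod.fst h).symm
  refine hVC {x, z} (Finset.card_pair hz.symm) fun l => ?_
  by_cases hl : l x = y
  · obtain ⟨g, hg, hgz⟩ := exists_apply_eq_of_mem_DIS hd (l z)
    have hgx : g x = y := hg.2 (x, y) ⟨⟨Or.inl rfl, hy⟩, hne⟩
    exact ⟨g, hg.1, by simp [hgx, hgz, hl]⟩
  · obtain ⟨g, hg, hgz⟩ := exists_apply_eq_of_mem_DIS hd' (l z)
    have hgx : g x = f x := hg.1.2
    have hlx : l x = f x := (Bool.eq_not.2 hl).trans (Bool.eq_not.2 hy).symm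
    exact ⟨g, hg.1.1, by simp [hgx, hgz, hlx]⟩

theorem ncard_Gamma_insert_add_le {F : Set (X → Bool)}
    (hVC : ∀ s : Finset X, s.card = 2 → ¬ShattersFinset F s) {f : X → Bool}
    {S : Set (X × Bool)} (hfin : S.Finite) {x : X} {y : Bool} (hy : f x ≠ y) :
    (Gamma (insert (x, y) S) F f).ncard + (Gamma S (restrictPoint F x (f x)) f).ncard
      ≤ (Gamma S F f).ncard + 1 := by
  have hsub := Gamma_insert_diff_subset S F f x y
  have hunion := Set.ncard_le_ncard
    (Set.union_subset hsub (Gamma_mono_left (restrictPoint_subset F x (f x)) S f))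
    (finite_Gamma hfin F f)
  rw [Set.ncard_union_eq (disjoint_Gamma_insert_diff hVC hy)
    ((finite_Gamma hfin F f).subset hsub) (finite_Gamma hfin _ f)] at hunion
  have := ncard_Gamma_insert_le S F f x y
  omega

theorem agreedLabel_eq {G : Set (X → Bool)} {g : X → Bool} (hg : g ∈ G) {x : X}
    (hx : x ∉ DIS G) : agreedLabel G x = g x := by
  have h : ∀ k ∈ G, k x = g x := fun k hk => by
    by_contra hne
    exact hx ⟨k, hk, g, hg, hne⟩
  unfold agreedLabel
  split_ifs with ht
  · exact (ht g hg).symm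
  · push Not at ht
    obtain ⟨k, hk, hkx⟩ := ht
    simpa [h k hk] using hkx.symm

/-- Algorithm 2 errs only by following the reference function against the target. -/
theorem of_alg2Learner_eq_not {F : Set (X → Bool)} {f fstar : X → Bool} (hfstar : fstar ∈ F)
    {α : ℝ} {S : List (X × Bool)} (hS : ∀ p ∈ S, fstar p.1 = p.2) {x : X}
    (h : alg2Learner F f α S x = some (!(fstar x))) :
    f x ≠ fstar x ∧ α ≤ ((Gamma {p | p ∈ S} (restrictPoint F x (f x)) f).ncard : ℝ) := by
  simp only [alg2Learner] at h
  split_ifs at h with hx hα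
  · refine ⟨fun he => ?_, hα⟩
    simp [he] at h
  · have hmem : fstar ∈ restrictC F {p | p ∈ S} := ⟨hfstar, hS⟩
    simp [agreedLabel_eq hmem hx] at h

theorem eq_of_mem_histS (fstar : X → Bool) (xh : ℕ → X) (t : ℕ) :
    ∀ p ∈ histS fstar xh t, fstar p.1 = p.2 := by
  induction t with
  | zero => simp [histS]
  | succ t ih =>
    intro p hp
    rcases List.mem_append.1 hp with hp | hp
    · exact ih p hp
    · rw [List.mem_singleton.1 hp]

theorem setOf_mem_histS_succ (fstar : X → Bool) (xh : ℕ → X) (t : ℕ) :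
    {p | p ∈ histS fstar xh (t + 1)}
      = insert (xh t, fstar (xh t)) {p | p ∈ histS fstar xh t} := by
  ext p
  simp [histS, or_comm]

theorem stmt3 (F : Set (X → Bool)) (hVC : VCdimEq F 1)
    (f : X → Bool) (hf : f ∈ F) (α : ℝ)
    (fstar : X → Bool) (hfstar : fstar ∈ F)
    (xh : ℕ → X) (T : ℕ) :
    ∀ t ∈ Finset.Icc 1 T,
      ((Gamma {p | p ∈ histS fstar xh t} F f).ncard : ℝ)
        ≤ ((Gamma {p | p ∈ histS fstar xh (t - 1)} F f).ncard : ℝ)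
          - α * (if alg2Learner F f α (histS fstar xh (t - 1)) (xh (t - 1))
                    = some (!(fstar (xh (t - 1)))) then 1 else 0)
          + 1 := by
  intro t ht
  obtain ⟨n, rfl⟩ : ∃ n, t = n + 1 := ⟨t - 1, by have := (Finset.mem_Icc.1 ht).1; omega⟩
  have hfin : {p | p ∈ histS fstar xh n}.Finite := List.finite_toSet _
  have hlab := eq_of_mem_histS fstar xh n
  rw [Nat.add_sub_cancel, setOf_mem_histS_succ]
  split_ifs with hmis
  · obtain ⟨hne, hα⟩ := of_alg2Learner_eq_not hfstar hlab hmis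
    have h := Nat.cast_le (α := ℝ).2 (ncard_Gamma_insert_add_le (F := F) hVC.2 hfin hne)
    push_cast at h
    linarith
  · have hsub := Gamma_insert_diff_subset {p | p ∈ histS fstar xh n} F f (xh n) (fstar (xh n))
    have hcard := (ncard_Gamma_insert_le _ F f (xh n) (fstar (xh n))).trans
      (Nat.add_le_add_right (Set.ncard_le_ncard hsub (finite_Gamma hfin F f)) 1)
    have h := Nat.cast_le (α := ℝ).2 hcard
    push_cast at h
    linarith

end Stmt3
end

section
/- Let F be a binary hypothesis class with VCdim(F) = 1. Then Algorithm 2 run with abstention threshold α over time horizon T makes at most T/α misclassifications: MisclassificationError_T ≤ T/α. -/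
/-!
STATEMENT 4: For a binary hypothesis class `F` with `VCdim(F) = 1`, Algorithm 2
run with abstention threshold `α` over time horizon `T` makes at most `T/α`
misclassifications, whatever the (possibly adversarial) stream of points is:
`MisclassificationError_T ≤ T/α`.
-/

open scoped Classical

namespace Stmt4

variable {X : Type*}

/-- Disagreement region of a class of hypotheses. -/
def DIS (G : Set (X → Bool)) : Set X :=
  {x | ∃ g ∈ G, ∃ h ∈ G, g x ≠ h x}

/-- The common label of all hypotheses of `G` at `x` (when all agree). -/
noncomputable def agreedLabel (G : Set (X → Bool)) (x : X) : Bool :=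
  if ∀ h ∈ G, h x = true then true else false

/-- `F` shatters the finite set `s`. -/
def ShattersFinset (F : Set (X → Bool)) (s : Finset X) : Prop :=
  ∀ y : X → Bool, ∃ h ∈ F, ∀ x ∈ s, h x = y x

/-- `VCdim(F) = d`: some set of size `d` is shattered and no set of size `d+1` is. -/
def VCdimEq (F : Set (X → Bool)) (d : ℕ) : Prop :=
  (∃ s : Finset X, s.card = d ∧ ShattersFinset F s) ∧
    ∀ s : Finset X, s.card = d + 1 → ¬ShattersFinset F s

/-- Restriction of a class to a set of labeled examples (the consistent hypotheses). -/
def restrictC (F : Set (X → Bool)) (S : Set (X × Bool)) : Set (X → Bool) :=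
  {h | h ∈ F ∧ ∀ p ∈ S, h p.1 = p.2}

/-- Restriction of a class to one additional labeled example: `G^{x→b}`. -/
def restrictPoint (G : Set (X → Bool)) (x : X) (b : Bool) : Set (X → Bool) :=
  {h | h ∈ G ∧ h x = b}

/-- The labeled examples of `S` disagreeing with the reference function `f`. -/
def Sref (f : X → Bool) (S : Set (X × Bool)) : Set (X × Bool) :=
  {p ∈ S | f p.1 ≠ p.2}

/-- The leave-one-out disagreement estimate `Γ(S, F, f)`. -/
def Gamma (S : Set (X × Bool)) (F : Set (X → Bool)) (f : X → Bool) : Set X :=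
  {x | ∃ y, (x, y) ∈ S ∧ x ∈ DIS (restrictC F (Sref f S \ {(x, y)}))}
/-- The learner of Algorithm 2 with reference function `f` and abstention
threshold `α`: predict the consistent label outside the disagreement region of
the current version space; inside it, predict `f(x̂)` if
`a₀ = |Γ(S, F^{x̂→f(x̂)}, f)| ≥ α` and abstain otherwise. -/
noncomputable def alg2Learner (F : Set (X → Bool)) (f : X → Bool) (α : ℝ) :
    List (X × Bool) → X → Option Bool := fun S x =>
  let Sset : Set (X × Bool) := {p | p ∈ S}
  let V := restrictC F Sset
  if x ∉ DIS V then some (agreedLabel V x)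
  else if α ≤ ((Gamma Sset (restrictPoint F x (f x)) f).ncard : ℝ) then some (f x)
  else none
/-- The labeled history after `t` rounds of an arbitrary (possibly adversarial)
stream `xh` of points labeled by the target `fstar`: `S_t`. -/
def histS (fstar : X → Bool) (xh : ℕ → X) : ℕ → List (X × Bool)
  | 0 => []
  | t + 1 => histS fstar xh t ++ [(xh t, fstar (xh t))]

/-- Number of misclassified predictions of the learner `learn` in the first `T`
rounds of the stream `xh` labeled by the target `fstar`. -/
noncomputable def misErrS (learn : List (X × Bool) → X → Option Bool)
    (fstar : X → Bool) (xh : ℕ → X) (T : ℕ) : ℕ :=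
  ∑ t ∈ Finset.range T,
    if learn (histS fstar xh t) (xh t) = some (!(fstar (xh t))) then 1 else 0

theorem VCdimEq.exists_missing_pattern {F : Set (X → Bool)} (hVC : VCdimEq F 1) {x z : X}
    (hxz : x ≠ z) : ∃ a b : Bool, ∀ h ∈ F, h x = a → h z ≠ b := by
  by_contra! hall
  refine hVC.2 {x, z} (Finset.card_pair hxz) fun y => ?_
  obtain ⟨h, hF, hx, hz⟩ := hall (y x) (y z)
  exact ⟨h, hF, by simp [hx, hz]⟩

theorem mem_histS {fstar : X → Bool} {xh : ℕ → X} {t : ℕ} {p : X × Bool} :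
    p ∈ histS fstar xh t ↔ ∃ i < t, p = (xh i, fstar (xh i)) := by
  induction t with
  | zero => simp [histS]
  | succ t ih =>
    simp only [histS, List.mem_append, ih, List.mem_singleton, Nat.lt_succ_iff_lt_or_eq]
    constructor
    · rintro (⟨i, hi, rfl⟩ | rfl)
      exacts [⟨i, Or.inl hi, rfl⟩, ⟨t, Or.inr rfl, rfl⟩]
    · rintro ⟨i, hi | rfl, rfl⟩
      exacts [Or.inl ⟨i, hi, rfl⟩, Or.inr rfl]

theorem exists_eq_of_mem_DIS {G : Set (X → Bool)} {x : X} (hx : x ∈ DIS G) (b : Bool) :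
    ∃ h ∈ G, h x = b := by
  obtain ⟨g, hg, h, hh, hne⟩ := hx
  by_cases hb : g x = b
  · exact ⟨g, hg, hb⟩
  · refine ⟨h, hh, ?_⟩
    revert hne hb
    cases g x <;> cases h x <;> cases b <;> simp

theorem agreedLabel_eq {G : Set (X → Bool)} {x : X} {g : X → Bool} (hg : g ∈ G)
    (hx : x ∉ DIS G) : agreedLabel G x = g x := by
  have hagree : ∀ h ∈ G, h x = g x := fun h hh => by
    by_contra hne
    exact hx ⟨h, hh, g, hg, hne⟩
  unfold agreedLabel
  split_ifs with hall
  · exact (hall g hg).symm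
  · cases hgx : g x
    · rfl
    · exact absurd (fun h hh => (hagree h hh).trans hgx) hall

/-- The set of points whose cardinality decides the prediction in round `t`. -/
def roundGamma (F : Set (X → Bool)) (f fstar : X → Bool) (xh : ℕ → X) (t : ℕ) : Set X :=
  Gamma {p | p ∈ histS fstar xh t} (restrictPoint F (xh t) (f (xh t))) f

theorem of_misclassified {F : Set (X → Bool)} {f fstar : X → Bool} {α : ℝ} {xh : ℕ → X} {t : ℕ}
    (hfstar : fstar ∈ F)
    (hmis : alg2Learner F f α (histS fstar xh t) (xh t) = some (!(fstar (xh t)))) :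
    f (xh t) ≠ fstar (xh t) ∧ α ≤ ((roundGamma F f fstar xh t).ncard : ℝ) := by
  have hV : fstar ∈ restrictC F {p | p ∈ histS fstar xh t} := by
    refine ⟨hfstar, fun p hp => ?_⟩
    obtain ⟨i, -, rfl⟩ := mem_histS.1 hp
    rfl
  simp only [alg2Learner] at hmis
  split_ifs at hmis with hdis hα
  · simp only [Option.some.injEq] at hmis
    exact ⟨by simp [hmis], hα⟩
  · rw [agreedLabel_eq hV hdis] at hmis
    simp at hmis

theorem roundGamma_subset {F : Set (X → Bool)} {f fstar : X → Bool} {xh : ℕ → X} {t : ℕ} {x : X}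
    (hx : x ∈ roundGamma F f fstar xh t) : ∃ i < t, xh i = x := by
  obtain ⟨y, hy, -⟩ := hx
  obtain ⟨i, hi, heq⟩ := mem_histS.1 hy
  exact ⟨i, hi, (congrArg Prod.fst heq).symm⟩

theorem exists_of_mem_roundGamma {F : Set (X → Bool)} {f fstar : X → Bool} {xh : ℕ → X} {t : ℕ}
    {x : X} (hx : x ∈ roundGamma F f fstar xh t) (b : Bool) :
    ∃ h ∈ F, h (xh t) = f (xh t) ∧ h x = b ∧
      ∀ i < t, f (xh i) ≠ fstar (xh i) → xh i ≠ x → h (xh i) = fstar (xh i) := by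
  obtain ⟨y, -, hdis⟩ := hx
  obtain ⟨h, ⟨⟨hF, ht⟩, hS⟩, hb⟩ := exists_eq_of_mem_DIS hdis b
  refine ⟨h, hF, ht, hb, fun i hi hne hix => ?_⟩
  refine hS (xh i, fstar (xh i)) ⟨⟨mem_histS.2 ⟨i, hi, rfl⟩, hne⟩, fun heq => hix ?_⟩
  exact congrArg Prod.fst (Set.mem_singleton_iff.1 heq)

theorem notMem_roundGamma_of_lt {F : Set (X → Bool)} (hVC : VCdimEq F 1) {f fstar : X → Bool}
    (hf : f ∈ F) (hfstar : fstar ∈ F) {xh : ℕ → X} {t u : ℕ} (htu : t < u)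
    (ht : f (xh t) ≠ fstar (xh t)) {x : X} (hx : x ∈ roundGamma F f fstar xh t) :
    x ∉ roundGamma F f fstar xh u := by
  intro hx'
  obtain ⟨h, hF, hht, hhx, -⟩ := exists_of_mem_roundGamma hx (!(f x))
  have hne : x ≠ xh t := by
    rintro rfl
    simp [hht] at hhx
  obtain ⟨g, gF, -, hgx, hg⟩ := exists_of_mem_roundGamma hx' (!(fstar x))
  have hgt := hg t htu ht hne.symm
  obtain ⟨a, b, hab⟩ := hVC.exists_missing_pattern hne
  have h1 := hab f hf
  have h2 := hab fstar hfstar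
  have h3 := hab h hF
  have h4 := hab g gF
  rw [hht, hhx] at h3
  rw [hgt, hgx] at h4
  revert h1 h2 h3 h4 ht
  cases f x <;> cases fstar x <;> cases f (xh t) <;> cases fstar (xh t) <;> cases a <;>
    cases b <;> simp

theorem stmt4 (F : Set (X → Bool)) (hVC : VCdimEq F 1)
    (f : X → Bool) (hf : f ∈ F) (α : ℝ) (hα : 0 < α)
    (fstar : X → Bool) (hfstar : fstar ∈ F)
    (xh : ℕ → X) (T : ℕ) :
    (misErrS (alg2Learner F f α) fstar xh T : ℝ) ≤ T / α := by
  set M := (Finset.range T).filter fun t =>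
    alg2Learner F f α (histS fstar xh t) (xh t) = some (!(fstar (xh t))) with hM
  have hcount : misErrS (alg2Learner F f α) fstar xh T = M.card := by
    rw [misErrS, hM, Finset.card_filter]
  have hmis : ∀ t ∈ M, t < T ∧ f (xh t) ≠ fstar (xh t) ∧
      α ≤ ((roundGamma F f fstar xh t).ncard : ℝ) := fun t ht => by
    obtain ⟨htT, ht⟩ := Finset.mem_filter.1 ht
    exact ⟨Finset.mem_range.1 htT, of_misclassified hfstar ht⟩
  let P : Finset X := (Finset.range T).image xh
  let G : ℕ → Finset X := fun t => P.filter (· ∈ roundGamma F f fstar xh t)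
  have hG : ∀ t ∈ M, α ≤ ((G t).card : ℝ) := fun t ht => by
    obtain ⟨htT, -, hα⟩ := hmis t ht
    have hcoe : roundGamma F f fstar xh t = (G t : Set X) := by
      ext x
      simp only [G, P, Finset.coe_filter, Set.mem_ofPred_eq, Finset.mem_image, Finset.mem_range]
      refine ⟨fun hx => ⟨?_, hx⟩, And.right⟩
      obtain ⟨i, hi, hix⟩ := roundGamma_subset hx
      exact ⟨i, hi.trans htT, hix⟩
    rwa [hcoe, Set.ncard_coe_finset] at hα
  have hdisj : (M : Set ℕ).PairwiseDisjoint G := fun t ht u hu htu => by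
    refine Finset.disjoint_left.2 fun x hxt hxu => ?_
    have hxt := (Finset.mem_filter.1 hxt).2
    have hxu := (Finset.mem_filter.1 hxu).2
    rcases lt_or_gt_of_ne htu with hlt | hlt
    · exact notMem_roundGamma_of_lt hVC hf hfstar hlt (hmis t ht).2.1 hxt hxu
    · exact notMem_roundGamma_of_lt hVC hf hfstar hlt (hmis u hu).2.1 hxu hxt
  have hcard : ∑ t ∈ M, (G t).card ≤ T := by
    rw [← Finset.card_biUnion hdisj]
    calc (M.biUnion G).card ≤ P.card :=
          Finset.card_le_card (Finset.biUnion_subset.2 fun t _ => Finset.filter_subset _ _)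
      _ ≤ T := by simpa using Finset.card_image_le (s := Finset.range T) (f := xh)
  rw [hcount, le_div_iff₀ hα]
  calc (M.card : ℝ) * α = ∑ t ∈ M, α := by simp
    _ ≤ ∑ t ∈ M, ((G t).card : ℝ) := Finset.sum_le_sum hG
    _ ≤ T := by exact_mod_cast hcard

end Stmt4
end

section
/- Let F be a binary hypothesis class over X with VCdim(F) = 1, let f ∈ F be a fixed reference function, let S be a realizable labeled data set, and let x̂ ∈ X. Then |Γ(S, F^{x̂→0}, f)| + |Γ(S, F^{x̂→1}, f)| ≤ |Γ(S, F, f)|. -/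
/-!
STATEMENT 11: For a binary hypothesis class `F` over `X` with `VCdim(F) = 1`, a
fixed reference function `f ∈ F`, a realizable labeled data set `S` and any
point `x̂ ∈ X`:
`|Γ(S, F^{x̂→0}, f)| + |Γ(S, F^{x̂→1}, f)| ≤ |Γ(S, F, f)|`.
-/

open scoped Classical

namespace Stmt11

variable {X : Type*}

/-- Disagreement region of a class of hypotheses. -/
def DIS (G : Set (X → Bool)) : Set X :=
  {x | ∃ g ∈ G, ∃ h ∈ G, g x ≠ h x}

/-- The common label of all hypotheses of `G` at `x` (when all agree). -/
noncomputable def agreedLabel (G : Set (X → Bool)) (x : X) : Bool :=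
  if ∀ h ∈ G, h x = true then true else false

/-- `F` shatters the finite set `s`. -/
def ShattersFinset (F : Set (X → Bool)) (s : Finset X) : Prop :=
  ∀ y : X → Bool, ∃ h ∈ F, ∀ x ∈ s, h x = y x

/-- `VCdim(F) = d`: some set of size `d` is shattered and no set of size `d+1` is. -/
def VCdimEq (F : Set (X → Bool)) (d : ℕ) : Prop :=
  (∃ s : Finset X, s.card = d ∧ ShattersFinset F s) ∧
    ∀ s : Finset X, s.card = d + 1 → ¬ShattersFinset F s

/-- Restriction of a class to a set of labeled examples (the consistent hypotheses). -/
def restrictC (F : Set (X → Bool)) (S : Set (X × Bool)) : Set (X → Bool) :=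
  {h | h ∈ F ∧ ∀ p ∈ S, h p.1 = p.2}

/-- Restriction of a class to one additional labeled example: `G^{x→b}`. -/
def restrictPoint (G : Set (X → Bool)) (x : X) (b : Bool) : Set (X → Bool) :=
  {h | h ∈ G ∧ h x = b}

/-- The labeled examples of `S` disagreeing with the reference function `f`. -/
def Sref (f : X → Bool) (S : Set (X × Bool)) : Set (X × Bool) :=
  {p ∈ S | f p.1 ≠ p.2}

/-- The leave-one-out disagreement estimate `Γ(S, F, f)`. -/
def Gamma (S : Set (X × Bool)) (F : Set (X → Bool)) (f : X → Bool) : Set X :=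
  {x | ∃ y, (x, y) ∈ S ∧ x ∈ DIS (restrictC F (Sref f S \ {(x, y)}))}

theorem DIS_mono {G H : Set (X → Bool)} (h : G ⊆ H) : DIS G ⊆ DIS H :=
  fun _ ⟨g, hg, k, hk, hne⟩ => ⟨g, h hg, k, h hk, hne⟩

theorem restrictC_mono {F G : Set (X → Bool)} (h : F ⊆ G) (S : Set (X × Bool)) :
    restrictC F S ⊆ restrictC G S :=
  fun _ hg => ⟨h hg.1, hg.2⟩

theorem restrictPoint_subset (F : Set (X → Bool)) (x : X) (b : Bool) :
    restrictPoint F x b ⊆ F :=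
  fun _ hg => hg.1

theorem Gamma_mono {F G : Set (X → Bool)} (h : F ⊆ G) (S : Set (X × Bool)) (f : X → Bool) :
    Gamma S F f ⊆ Gamma S G f :=
  fun _ ⟨y, hy, hx⟩ => ⟨y, hy, DIS_mono (restrictC_mono h _) hx⟩

theorem finite_Gamma (S : Finset (X × Bool)) (F : Set (X → Bool)) (f : X → Bool) :
    (Gamma (↑S) F f).Finite :=
  (S.finite_toSet.image Prod.fst).subset fun x ⟨y, hy, _⟩ => ⟨(x, y), hy, rfl⟩

theorem exists_eq_of_mem_DIS {G : Set (X → Bool)} {x : X} (h : x ∈ DIS G) (b : Bool) :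
    ∃ g ∈ G, g x = b := by
  obtain ⟨g, hg, k, hk, hne⟩ := h
  by_cases hb : g x = b
  · exact ⟨g, hg, hb⟩
  · exact ⟨k, hk, by cases hgx : g x <;> cases hkx : k x <;> cases b <;> simp_all⟩

/-- A point at which `F^{x→b}` still disagrees for both labels `b` is shattered together
with `x`. -/
theorem shattersFinset_pair {F : Set (X → Bool)} {x z : X}
    (h : ∀ b, z ∈ DIS (restrictPoint F x b)) : ShattersFinset F {z, x} := by
  intro y
  obtain ⟨g, ⟨hgF, hgx⟩, hgz⟩ := exists_eq_of_mem_DIS (h (y x)) (y z)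
  exact ⟨g, hgF, by simp [hgx, hgz]⟩

theorem ne_of_mem_DIS_restrictPoint {F : Set (X → Bool)} {x z : X} {b : Bool}
    (h : z ∈ DIS (restrictPoint F x b)) : z ≠ x := by
  rintro rfl
  obtain ⟨g, hg, k, hk, hne⟩ := h
  exact hne (hg.2.trans hk.2.symm)

theorem disjoint_Gamma_restrictPoint {F : Set (X → Bool)}
    (hF : ∀ s : Finset X, s.card = 2 → ¬ShattersFinset F s) (S : Set (X × Bool))
    (f : X → Bool) (x : X) :
    Disjoint (Gamma S (restrictPoint F x false) f) (Gamma S (restrictPoint F x true) f) := by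
  rw [Set.disjoint_left]
  rintro z ⟨y₀, -, h₀⟩ ⟨y₁, -, h₁⟩
  have h₀' := DIS_mono (fun _ hg => hg.1) h₀
  have h₁' := DIS_mono (fun _ hg => hg.1) h₁
  exact hF {z, x} (Finset.card_pair (ne_of_mem_DIS_restrictPoint h₀'))
    (shattersFinset_pair (Bool.rec h₀' h₁'))

theorem stmt11 (F : Set (X → Bool)) (hVC : VCdimEq F 1)
    (f : X → Bool) (hf : f ∈ F)
    (fstar : X → Bool) (hfstar : fstar ∈ F)
    (S : Finset (X × Bool)) (hS : ∀ p ∈ S, p.2 = fstar p.1)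
    (xh : X) :
    (Gamma (↑S) (restrictPoint F xh false) f).ncard
        + (Gamma (↑S) (restrictPoint F xh true) f).ncard
      ≤ (Gamma (↑S) F f).ncard := by
  rw [← Set.ncard_union_eq (disjoint_Gamma_restrictPoint hVC.2 _ f xh)
    (finite_Gamma S _ f) (finite_Gamma S _ f)]
  exact Set.ncard_le_ncard
    (Set.union_subset (Gamma_mono (restrictPoint_subset F xh false) _ f)
      (Gamma_mono (restrictPoint_subset F xh true) _ f))
    (finite_Gamma S F f)

end Stmt11
end

section
/- Let F be a binary hypothesis class over X, f ∈ F a fixed reference function, S a realizable labeled data set, and x̂ ∈ X a point whose true label is y = 1 − f(x̂). Then |Γ(S ∪ {(x̂, y)}, F, f)| ≤ |Γ(S, F^{x̂→y}, f)| + 1. -/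
/-!
STATEMENT 12: For a binary hypothesis class `F` over `X`, a fixed reference
function `f ∈ F`, a realizable labeled data set `S`, and a point `x̂` whose true
label is `y = 1 − f(x̂)`:
`|Γ(S ∪ {(x̂, y)}, F, f)| ≤ |Γ(S, F^{x̂→y}, f)| + 1`.
-/

open scoped Classical

namespace Stmt12

variable {X : Type*}

/-- Disagreement region of a class of hypotheses. -/
def DIS (G : Set (X → Bool)) : Set X :=
  {x | ∃ g ∈ G, ∃ h ∈ G, g x ≠ h x}

/-- The common label of all hypotheses of `G` at `x` (when all agree). -/
noncomputable def agreedLabel (G : Set (X → Bool)) (x : X) : Bool :=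
  if ∀ h ∈ G, h x = true then true else false

/-- `F` shatters the finite set `s`. -/
def ShattersFinset (F : Set (X → Bool)) (s : Finset X) : Prop :=
  ∀ y : X → Bool, ∃ h ∈ F, ∀ x ∈ s, h x = y x

/-- `VCdim(F) = d`: some set of size `d` is shattered and no set of size `d+1` is. -/
def VCdimEq (F : Set (X → Bool)) (d : ℕ) : Prop :=
  (∃ s : Finset X, s.card = d ∧ ShattersFinset F s) ∧
    ∀ s : Finset X, s.card = d + 1 → ¬ShattersFinset F s

/-- Restriction of a class to a set of labeled examples (the consistent hypotheses). -/
def restrictC (F : Set (X → Bool)) (S : Set (X × Bool)) : Set (X → Bool) :=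
  {h | h ∈ F ∧ ∀ p ∈ S, h p.1 = p.2}

/-- Restriction of a class to one additional labeled example: `G^{x→b}`. -/
def restrictPoint (G : Set (X → Bool)) (x : X) (b : Bool) : Set (X → Bool) :=
  {h | h ∈ G ∧ h x = b}

/-- The labeled examples of `S` disagreeing with the reference function `f`. -/
def Sref (f : X → Bool) (S : Set (X × Bool)) : Set (X × Bool) :=
  {p ∈ S | f p.1 ≠ p.2}

/-- The leave-one-out disagreement estimate `Γ(S, F, f)`. -/
def Gamma (S : Set (X × Bool)) (F : Set (X → Bool)) (f : X → Bool) : Set X :=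
  {x | ∃ y, (x, y) ∈ S ∧ x ∈ DIS (restrictC F (Sref f S \ {(x, y)}))}

theorem Gamma_finite {S : Set (X × Bool)} (hS : S.Finite) (F : Set (X → Bool)) (f : X → Bool) :
    (Gamma S F f).Finite :=
  (hS.image Prod.fst).subset fun _ ⟨y, hxy, _⟩ => ⟨(_, y), hxy, rfl⟩

theorem Gamma_union_singleton_subset (S : Set (X × Bool)) (F : Set (X → Bool)) (f : X → Bool)
    {xh : X} {y : Bool} (hy : f xh ≠ y) :
    Gamma (S ∪ {(xh, y)}) F f ⊆ insert xh (Gamma S (restrictPoint F xh y) f) := by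
  rintro x ⟨z, hxz, g, hg, h, hh, hgh⟩
  by_cases hx : x = xh
  · exact Or.inl hx
  have hne : (xh, y) ≠ (x, z) := fun e => hx (congrArg Prod.fst e).symm
  have mem_restrict : ∀ k ∈ restrictC F (Sref f (S ∪ {(xh, y)}) \ {(x, z)}),
      k ∈ restrictC (restrictPoint F xh y) (Sref f S \ {(x, z)}) := fun k hk =>
    ⟨⟨hk.1, hk.2 (xh, y) ⟨⟨Or.inr rfl, hy⟩, hne⟩⟩,
      fun p hp => hk.2 p ⟨⟨Or.inl hp.1.1, hp.1.2⟩, hp.2⟩⟩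
  exact Or.inr ⟨z, hxz.resolve_right fun e => hne e.symm,
    g, mem_restrict g hg, h, mem_restrict h hh, hgh⟩

theorem stmt12 (F : Set (X → Bool))
    (f : X → Bool) (hf : f ∈ F)
    (fstar : X → Bool) (hfstar : fstar ∈ F)
    (S : Finset (X × Bool)) (hS : ∀ p ∈ S, p.2 = fstar p.1)
    (xh : X) (y : Bool) (hy : y = !(f xh)) (hylabel : fstar xh = y) :
    (Gamma (↑S ∪ {(xh, y)}) F f).ncard
      ≤ (Gamma (↑S) (restrictPoint F xh y) f).ncard + 1 := by
  have hfy : f xh ≠ y := by simp [hy]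
  exact (Set.ncard_le_ncard (Gamma_union_singleton_subset S F f hfy)
    ((Gamma_finite S.finite_toSet _ f).insert xh)).trans (Set.ncard_insert_le _ _)

end Stmt12
end

section
/- Let D be a probability distribution on [0,1], let f* be a threshold function 1_{x ≤ a*}, and let X_1,…,X_n be i.i.d. samples from D. Then the probability that X_n lies in the disagreement region of the threshold class F = {1_{x ≤ a} : a ∈ [0,1]} restricted to the labeled examples {(X_i, f*(X_i)) : 1 ≤ i ≤ n−1} is at most 2/n. -/
/-!
STATEMENT 13: For a distribution `D` on `[0,1]`, a threshold target
`f* = 1_{x ≤ a*}` and i.i.d. samples `X_1, …, X_n ~ D`, the probability that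
`X_n` lies in the disagreement region of the threshold class restricted to the
labeled examples `{(X_i, f*(X_i)) : i ≤ n−1}` is at most `2/n`.
-/

open MeasureTheory
open scoped ENNReal Classical

namespace Stmt13

variable {X : Type*}

/-- Disagreement region of a class of hypotheses. -/
def DIS (G : Set (X → Bool)) : Set X :=
  {x | ∃ g ∈ G, ∃ h ∈ G, g x ≠ h x}

/-- The common label of all hypotheses of `G` at `x` (when all agree). -/
noncomputable def agreedLabel (G : Set (X → Bool)) (x : X) : Bool :=
  if ∀ h ∈ G, h x = true then true else false

/-- `F` shatters the finite set `s`. -/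
def ShattersFinset (F : Set (X → Bool)) (s : Finset X) : Prop :=
  ∀ y : X → Bool, ∃ h ∈ F, ∀ x ∈ s, h x = y x

/-- `VCdim(F) = d`: some set of size `d` is shattered and no set of size `d+1` is. -/
def VCdimEq (F : Set (X → Bool)) (d : ℕ) : Prop :=
  (∃ s : Finset X, s.card = d ∧ ShattersFinset F s) ∧
    ∀ s : Finset X, s.card = d + 1 → ¬ShattersFinset F s

/-- Restriction of a class to a set of labeled examples (the consistent hypotheses). -/
def restrictC (F : Set (X → Bool)) (S : Set (X × Bool)) : Set (X → Bool) :=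
  {h | h ∈ F ∧ ∀ p ∈ S, h p.1 = p.2}

/-- Restriction of a class to one additional labeled example: `G^{x→b}`. -/
def restrictPoint (G : Set (X → Bool)) (x : X) (b : Bool) : Set (X → Bool) :=
  {h | h ∈ G ∧ h x = b}

/-- The labeled examples of `S` disagreeing with the reference function `f`. -/
def Sref (f : X → Bool) (S : Set (X × Bool)) : Set (X × Bool) :=
  {p ∈ S | f p.1 ≠ p.2}

/-- The leave-one-out disagreement estimate `Γ(S, F, f)`. -/
def Gamma (S : Set (X × Bool)) (F : Set (X → Bool)) (f : X → Bool) : Set X :=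
  {x | ∃ y, (x, y) ∈ S ∧ x ∈ DIS (restrictC F (Sref f S \ {(x, y)}))}
/-- The threshold hypothesis `1_{x ≤ a}`. -/
noncomputable def thresh (a : ℝ) : ℝ → Bool := fun x => if x ≤ a then true else false

/-- The class of thresholds on `[0,1]`. -/
noncomputable def thresholdClass : Set (ℝ → Bool) :=
  {h | ∃ a ∈ Set.Icc (0 : ℝ) 1, h = thresh a}

/-- Among i.i.d. samples, the probability that a given one is the strict extremum, for an asymmetric
relation `r`, of the samples falling in `S` is at most the inverse of the number of samples. -/
theorem pi_strict_extremum_le {α ι : Type*} [MeasurableSpace α] [Fintype ι]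
    (μ : Measure α) [IsProbabilityMeasure μ] {S : Set α} (hS : MeasurableSet S)
    {r : α → α → Prop} (hr : MeasurableSet {p : α × α | r p.1 p.2})
    (hasymm : ∀ x y, r x y → ¬ r y x) (j : ι) :
    Measure.pi (fun _ : ι => μ) {v | v j ∈ S ∧ ∀ i, i ≠ j → v i ∈ S → r (v i) (v j)}
      ≤ (Fintype.card ι : ℝ≥0∞)⁻¹ := by
  set P := Measure.pi (fun _ : ι => μ)
  let E : ι → Set (ι → α) := fun k => {v | v k ∈ S ∧ ∀ i, i ≠ k → v i ∈ S → r (v i) (v k)}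
  have hE : ∀ k, MeasurableSet (E k) := by
    intro k
    have h : E k = {v | v k ∈ S} ∩ ⋂ i, {v | i ≠ k → v i ∈ S → r (v i) (v k)} := by
      ext v
      simp [E]
    rw [h]
    refine (measurable_pi_apply k hS).inter (MeasurableSet.iInter fun i => ?_)
    refine (MeasurableSet.const _).imp (MeasurableSet.imp (measurable_pi_apply i hS) ?_)
    have hpair : Measurable fun v : ι → α => (v i, v k) :=
      (measurable_pi_apply i).prodMk (measurable_pi_apply k)
    exact hpair hr
  have hdisj : Pairwise (Function.onFun Disjoint E) := by
    intro k l hkl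
    refine Set.disjoint_left.mpr fun v hk hl => ?_
    exact hasymm _ _ (hk.2 l hkl.symm hl.1) (hl.2 k hkl hk.1)
  have heq : ∀ k, P (E k) = P (E j) := by
    intro k
    have hmp := measurePreserving_piCongrLeft (fun _ : ι => μ) (Equiv.swap k j)
    rw [← hmp.measure_preimage_equiv]
    congr 1
    ext v
    have happ : ∀ i, MeasurableEquiv.piCongrLeft (fun _ : ι => α) (Equiv.swap k j) v i
        = v (Equiv.swap k j i) := by
      intro i
      conv_lhs => rw [← Equiv.swap_apply_self k j i]
      exact Equiv.piCongrLeft_apply_apply (fun _ : ι => α) (Equiv.swap k j) v _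
    simp only [E, Set.mem_preimage, Set.mem_ofPred_eq, happ, Equiv.swap_apply_left]
    refine and_congr_right fun _ => ?_
    rw [← (Equiv.swap k j).forall_congr_right (q := fun i => i ≠ j → v i ∈ S → r (v i) (v j))]
    refine forall_congr' fun i => ?_
    rw [Ne, Ne, Equiv.swap_apply_eq_iff, Equiv.swap_apply_right]
  have hsum : (Fintype.card ι : ℝ≥0∞) * P (E j) ≤ 1 := by
    calc (Fintype.card ι : ℝ≥0∞) * P (E j) = ∑ k, P (E k) := by simp [heq]
      _ = P (⋃ k, E k) := by
        rw [measure_iUnion hdisj hE, tsum_fintype]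
      _ ≤ 1 := prob_le_one
  rw [ENNReal.le_inv_iff_mul_le, mul_comm]
  exact hsum

theorem thresh_eq_true_iff {a x : ℝ} : thresh a x = true ↔ x ≤ a := by
  simp [thresh]

/-- In the disagreement region of the thresholds consistent with labels from `thresh c`, a point is
strictly above all examples labeled `true`, and strictly below all examples labeled `false`. -/
theorem strict_extremum_of_mem_DIS {S : Set (ℝ × Bool)} {x c : ℝ}
    (hx : x ∈ DIS (restrictC thresholdClass S)) {y : ℝ} (hy : (y, thresh c y) ∈ S) :
    (y ≤ c → y < x) ∧ (c < y → x < y) := by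
  have key : ∀ a b : ℝ, thresh a ∈ restrictC thresholdClass S →
      thresh b ∈ restrictC thresholdClass S → a < x → x ≤ b →
      (y ≤ c → y < x) ∧ (c < y → x < y) := by
    intro a b ha hb hax hxb
    have h₁ : y ≤ a ↔ y ≤ c := by
      rw [← thresh_eq_true_iff, ← thresh_eq_true_iff, ha.2 _ hy]
    have h₂ : y ≤ b ↔ y ≤ c := by
      rw [← thresh_eq_true_iff, ← thresh_eq_true_iff, hb.2 _ hy]
    exact ⟨fun h => (h₁.mpr h).trans_lt hax,
      fun h => hxb.trans_lt (not_le.mp (mt h₂.mp h.not_ge))⟩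
  obtain ⟨g, hg, h, hh, hne⟩ := hx
  obtain ⟨a, -, rfl⟩ := hg.1
  obtain ⟨b, -, rfl⟩ := hh.1
  rw [Ne, Bool.eq_iff_iff, thresh_eq_true_iff, thresh_eq_true_iff] at hne
  by_cases hxb : x ≤ b
  · exact key a b hg hh (by by_contra! h; exact hne ⟨fun _ => hxb, fun _ => h⟩) hxb
  · have hxa : x ≤ a := by
      by_contra h
      exact hne ⟨fun h' => absurd h' h, fun h' => absurd h' hxb⟩
    exact key b a hh hg (not_le.mp hxb) hxa

theorem stmt13 (D : Measure ℝ) [IsProbabilityMeasure D] (hD : D (Set.Icc (0 : ℝ) 1) = 1)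
    (astar : ℝ) (hastar : astar ∈ Set.Icc (0 : ℝ) 1)
    (n : ℕ) (hn : 0 < n) :
    Measure.pi (fun _ : Fin n => D)
      {v : Fin n → ℝ |
        v ⟨n - 1, by omega⟩ ∈
          DIS (restrictC thresholdClass
            {p | ∃ i : Fin n, (i : ℕ) < n - 1 ∧ p = (v i, thresh astar (v i))})}
      ≤ 2 / (n : ℝ≥0∞) := by
  set j : Fin n := ⟨n - 1, by omega⟩
  have hlt : ∀ i : Fin n, i ≠ j → (i : ℕ) < n - 1 := by
    intro i hi
    have := Fin.val_ne_of_ne hi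
    simp only [j] at this
    omega
  have hbelow := pi_strict_extremum_le D (measurableSet_Iic (a := astar))
    (measurableSet_lt measurable_fst measurable_snd) (fun _ _ => lt_asymm) j
  have habove := pi_strict_extremum_le D (measurableSet_Ioi (a := astar))
    (r := fun x y => y < x)
    (measurableSet_lt measurable_snd measurable_fst) (fun _ _ => lt_asymm) j
  rw [Fintype.card_fin] at hbelow habove
  calc _ ≤ _ := measure_mono ?_
    _ ≤ _ := measure_union_le _ _
    _ ≤ _ := add_le_add hbelow habove
    _ = 2 / (n : ℝ≥0∞) := by rw [← two_mul, div_eq_mul_inv]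
  intro v hv
  have hext : ∀ i, i ≠ j → (v i ≤ astar → v i < v j) ∧ (astar < v i → v j < v i) :=
    fun i hi => strict_extremum_of_mem_DIS hv ⟨i, hlt i hi, rfl⟩
  rcases le_or_gt (v j) astar with h | h
  · exact Or.inl ⟨h, fun i hi => (hext i hi).1⟩
  · exact Or.inr ⟨h, fun i hi => (hext i hi).2⟩

end Stmt13
end

section
/- Let D be a probability distribution on ℝ^p, let f* be an axis-aligned rectangle classifier (f*(x) = 1 iff a_i* ≤ (x)_i ≤ b_i* for all i ∈ {1,…,p}), and let X_1,…,X_n be i.i.d. samples from D. Then the probability that f*(X_n) = 1 and X_n lies in the disagreement region of the class of axis-aligned rectangles restricted to the labeled examples {(X_i, f*(X_i)) : 1 ≤ i ≤ n−1} is at most 2p/n. -/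
/-!
STATEMENT 14: For a distribution `D` on `ℝ^p`, an axis-aligned rectangle target
`f*` and i.i.d. samples `X_1, …, X_n ~ D`, the probability that `f*(X_n) = 1`
and `X_n` lies in the disagreement region of the class of axis-aligned
rectangles restricted to the labeled examples `{(X_i, f*(X_i)) : i ≤ n−1}` is at
most `2p/n`.
-/

open MeasureTheory
open scoped ENNReal Classical

namespace Stmt14

variable {X : Type*}

/-- Disagreement region of a class of hypotheses. -/
def DIS (G : Set (X → Bool)) : Set X :=
  {x | ∃ g ∈ G, ∃ h ∈ G, g x ≠ h x}

/-- The common label of all hypotheses of `G` at `x` (when all agree). -/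
noncomputable def agreedLabel (G : Set (X → Bool)) (x : X) : Bool :=
  if ∀ h ∈ G, h x = true then true else false

/-- `F` shatters the finite set `s`. -/
def ShattersFinset (F : Set (X → Bool)) (s : Finset X) : Prop :=
  ∀ y : X → Bool, ∃ h ∈ F, ∀ x ∈ s, h x = y x

/-- `VCdim(F) = d`: some set of size `d` is shattered and no set of size `d+1` is. -/
def VCdimEq (F : Set (X → Bool)) (d : ℕ) : Prop :=
  (∃ s : Finset X, s.card = d ∧ ShattersFinset F s) ∧
    ∀ s : Finset X, s.card = d + 1 → ¬ShattersFinset F s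

/-- Restriction of a class to a set of labeled examples (the consistent hypotheses). -/
def restrictC (F : Set (X → Bool)) (S : Set (X × Bool)) : Set (X → Bool) :=
  {h | h ∈ F ∧ ∀ p ∈ S, h p.1 = p.2}

/-- Restriction of a class to one additional labeled example: `G^{x→b}`. -/
def restrictPoint (G : Set (X → Bool)) (x : X) (b : Bool) : Set (X → Bool) :=
  {h | h ∈ G ∧ h x = b}

/-- The labeled examples of `S` disagreeing with the reference function `f`. -/
def Sref (f : X → Bool) (S : Set (X × Bool)) : Set (X × Bool) :=
  {p ∈ S | f p.1 ≠ p.2}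

/-- The leave-one-out disagreement estimate `Γ(S, F, f)`. -/
def Gamma (S : Set (X × Bool)) (F : Set (X → Bool)) (f : X → Bool) : Set X :=
  {x | ∃ y, (x, y) ∈ S ∧ x ∈ DIS (restrictC F (Sref f S \ {(x, y)}))}

/-- The axis-aligned rectangle classifier with corners `a`, `b`. -/
noncomputable def rect {p : ℕ} (a b : Fin p → ℝ) : (Fin p → ℝ) → Bool :=
  fun x => if ∀ i, a i ≤ x i ∧ x i ≤ b i then true else false

/-- The class of axis-aligned rectangles in `ℝ^p`. -/
noncomputable def rectClass (p : ℕ) : Set ((Fin p → ℝ) → Bool) :=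
  {h | ∃ a b : Fin p → ℝ, (∀ i, a i ≤ b i) ∧ h = rect a b}

/-- Among `n` i.i.d. samples, the `k`-th one is the strict minimizer of `g` over the samples
falling into `S` with probability at most `1 / n`. -/
lemma measure_pi_strict_min_le {α : Type*} [MeasurableSpace α] (D : Measure α)
    [IsProbabilityMeasure D] {S : Set α} (hS : MeasurableSet S) {g : α → ℝ} (hg : Measurable g)
    {n : ℕ} (m : Fin n) :
    Measure.pi (fun _ : Fin n => D)
      {v | v m ∈ S ∧ ∀ j, j ≠ m → v j ∈ S → g (v m) < g (v j)} ≤ 1 / (n : ℝ≥0∞) := by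
  set E : Fin n → Set (Fin n → α) :=
    fun k => {v | v k ∈ S ∧ ∀ j, j ≠ k → v j ∈ S → g (v k) < g (v j)} with hE
  have hmeas : ∀ k, MeasurableSet (E k) := by
    intro k
    refine (measurable_pi_apply k hS).inter ?_
    change MeasurableSet {v : Fin n → α | ∀ j, j ≠ k → v j ∈ S → g (v k) < g (v j)}
    simp only [Set.ofPred_forall]
    refine MeasurableSet.iInter fun j => MeasurableSet.iInter fun _ => ?_
    have hlt : MeasurableSet {v : Fin n → α | g (v k) < g (v j)} :=
      measurableSet_lt (hg.comp (measurable_pi_apply k)) (hg.comp (measurable_pi_apply j))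
    have hSj : MeasurableSet {v : Fin n → α | v j ∈ S} := measurable_pi_apply j hS
    exact hSj.imp hlt
  have heq : ∀ k, Measure.pi (fun _ : Fin n => D) (E k) = Measure.pi (fun _ : Fin n => D) (E m) := by
    intro k
    have hmp := measurePreserving_piCongrLeft (fun _ : Fin n => D) (Equiv.swap k m)
    rw [← hmp.measure_preimage (hmeas k).nullMeasurableSet]
    congr 1
    ext v
    have hv : ∀ j, MeasurableEquiv.piCongrLeft (fun _ : Fin n => α) (Equiv.swap k m) v j =
        v (Equiv.swap k m j) := by
      intro j
      have := Equiv.piCongrLeft_apply_apply (fun _ : Fin n => α) (Equiv.swap k m) v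
        (Equiv.swap k m j)
      rwa [Equiv.swap_apply_self] at this
    simp only [hE, Set.mem_preimage, Set.mem_ofPred_eq, hv, Equiv.swap_apply_left]
    refine and_congr_right fun _ => ⟨fun h j hj hjS => ?_, fun h j hj hjS => ?_⟩
    · have := h (Equiv.swap k m j) (fun h' => hj (by
        rw [← Equiv.swap_apply_self k m j, h', Equiv.swap_apply_left]))
      rw [Equiv.swap_apply_self] at this
      exact this hjS
    · exact h _ (fun h' => hj (by
        rw [← Equiv.swap_apply_self k m j, h', Equiv.swap_apply_right])) hjS
  have hdisj : Pairwise (Function.onFun Disjoint E) := by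
    intro k l hkl
    refine Set.disjoint_left.2 fun v hk hl => ?_
    exact lt_asymm (hk.2 l hkl.symm hl.1) (hl.2 k hkl hk.1)
  have hsum : ∑ k, Measure.pi (fun _ : Fin n => D) (E k) ≤ 1 := by
    rw [← tsum_fintype (L := .unconditional _), ← measure_iUnion hdisj hmeas]
    exact prob_le_one
  simp only [heq, Finset.sum_const, Finset.card_univ, Fintype.card_fin, nsmul_eq_mul] at hsum
  rw [ENNReal.le_div_iff_mul_le (Or.inr one_ne_zero) (Or.inr ENNReal.one_ne_top), mul_comm]
  exact hsum

lemma rect_eq_true_iff {p : ℕ} {a b x : Fin p → ℝ} :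
    rect a b x = true ↔ ∀ i, a i ≤ x i ∧ x i ≤ b i := by
  simp [rect]

lemma measurableSet_rect {p : ℕ} (a b : Fin p → ℝ) :
    MeasurableSet {x | rect a b x = true} := by
  have h : {x | rect a b x = true} = Set.Icc a b := by
    ext x
    simp [rect, Pi.le_def, forall_and]
  rw [h]
  exact measurableSet_Icc

/-- A point on which two hypotheses of `G` disagree is labeled `false` by one of them. -/
lemma exists_eq_false_of_mem_DIS {G : Set (X → Bool)} {x : X} (hx : x ∈ DIS G) :
    ∃ h ∈ G, h x = false := by
  obtain ⟨g, hg, h, hh, hne⟩ := hx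
  cases hgx : g x
  · exact ⟨g, hg, hgx⟩
  · exact ⟨h, hh, by rw [hgx] at hne; simpa using hne.symm⟩

theorem stmt14 (p : ℕ) (hp : 0 < p)
    (D : Measure (Fin p → ℝ)) [IsProbabilityMeasure D]
    (astar bstar : Fin p → ℝ) (hab : ∀ i, astar i ≤ bstar i)
    (n : ℕ) (hn : 0 < n) :
    Measure.pi (fun _ : Fin n => D)
      {v : Fin n → Fin p → ℝ |
        rect astar bstar (v ⟨n - 1, by omega⟩) = true ∧
        v ⟨n - 1, by omega⟩ ∈
          DIS (restrictC (rectClass p)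
            {q | ∃ i : Fin n, (i : ℕ) < n - 1 ∧
              q = (v i, rect astar bstar (v i))})}
      ≤ 2 * (p : ℝ≥0∞) / (n : ℝ≥0∞) := by
  set m : Fin n := ⟨n - 1, by omega⟩
  set S : Set (Fin p → ℝ) := {x | rect astar bstar x = true}
  set A : Fin p → Set (Fin n → Fin p → ℝ) :=
    fun i => {v | v m ∈ S ∧ ∀ j, j ≠ m → v j ∈ S → v m i < v j i}
  set B : Fin p → Set (Fin n → Fin p → ℝ) :=
    fun i => {v | v m ∈ S ∧ ∀ j, j ≠ m → v j ∈ S → -v m i < -v j i}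
  refine (measure_mono (t := ⋃ i, A i ∪ B i) ?_).trans ?_
  · rintro v ⟨hpos, hdis⟩
    obtain ⟨h, ⟨⟨a, b, -, rfl⟩, hcons⟩, hfalse⟩ := exists_eq_false_of_mem_DIS hdis
    have hin : ∀ j, j ≠ m → v j ∈ S → ∀ i, a i ≤ v j i ∧ v j i ≤ b i := by
      intro j hj hjS
      have hlt : (j : ℕ) < n - 1 := by
        have : (j : ℕ) ≠ n - 1 := fun h' => hj (Fin.ext h')
        omega
      exact rect_eq_true_iff.1 ((hcons _ ⟨j, hlt, rfl⟩).trans hjS)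
    have hnot : ¬ ∀ i, a i ≤ v m i ∧ v m i ≤ b i := fun h' => by
      rw [rect_eq_true_iff.2 h'] at hfalse
      exact Bool.noConfusion hfalse
    obtain ⟨i, hi⟩ := not_forall.1 hnot
    refine Set.mem_iUnion.2 ⟨i, ?_⟩
    by_cases hai : a i ≤ v m i
    · have hbi : b i < v m i := not_le.1 fun h' => hi ⟨hai, h'⟩
      exact Or.inr ⟨hpos, fun j hj hjS => neg_lt_neg ((hin j hj hjS i).2.trans_lt hbi)⟩
    · exact Or.inl ⟨hpos, fun j hj hjS => (not_le.1 hai).trans_le (hin j hj hjS i).1⟩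
  · have hSm : MeasurableSet S := measurableSet_rect astar bstar
    have hAB : ∀ i, Measure.pi (fun _ : Fin n => D) (A i ∪ B i) ≤ 2 / (n : ℝ≥0∞) := by
      intro i
      refine (measure_union_le _ _).trans ?_
      refine (add_le_add (measure_pi_strict_min_le D hSm (measurable_pi_apply i) m)
        (measure_pi_strict_min_le D hSm (measurable_pi_apply i).neg m)).trans_eq ?_
      rw [ENNReal.div_add_div_same, one_add_one_eq_two]
    calc Measure.pi (fun _ : Fin n => D) (⋃ i, A i ∪ B i)
        ≤ ∑ i, Measure.pi (fun _ : Fin n => D) (A i ∪ B i) := measure_iUnion_fintype_le _ _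
      _ ≤ ∑ _i : Fin p, 2 / (n : ℝ≥0∞) := Finset.sum_le_sum fun i _ => hAB i
      _ = 2 * (p : ℝ≥0∞) / (n : ℝ≥0∞) := by
        rw [Finset.sum_const, Finset.card_univ, Fintype.card_fin, nsmul_eq_mul, ← mul_div_assoc,
          mul_comm (p : ℝ≥0∞)]

end Stmt14
end

section
/- Let D be a probability distribution on ℝ^p, let f* be an axis-aligned rectangle classifier with rectangle [a_1*,b_1*]×…×[a_p*,b_p*], let α ∈ ℕ⁺, and let X_1,…,X_n be i.i.d. samples from D. Then the probability that f*(X_n) = 0 and that in every dimension i ∈ {1,…,p} there are fewer than α indices s < n with (X_s)_i ∈ [(X_n)_i, a_i*) ∪ (b_i*, (X_n)_i] is at most 2αp/n. -/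
/-!
STATEMENT 15: For a distribution `D` on `ℝ^p`, an axis-aligned rectangle target
`f*` with rectangle `[a*₁,b*₁]×…×[a*_p,b*_p]`, a threshold `α ∈ ℕ⁺` and i.i.d.
samples `X_1, …, X_n ~ D`, the probability that `f*(X_n) = 0` and that in every
dimension `i` there are fewer than `α` indices `s < n` with
`(X_s)_i ∈ [(X_n)_i, a*_i) ∪ (b*_i, (X_n)_i]` is at most `2αp/n`.
-/

open MeasureTheory
open scoped ENNReal Classical

namespace Stmt15

/-- The axis-aligned rectangle classifier with corners `a`, `b`. -/
noncomputable def rect {p : ℕ} (a b : Fin p → ℝ) : (Fin p → ℝ) → Bool :=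
  fun x => if ∀ i, a i ≤ x i ∧ x i ≤ b i then true else false

/-- The samples `v` whose `k`-th entry has `f`-value below `c`, with fewer than `α` other entries
whose `f`-value lies between that of the `k`-th entry and `c`. -/
def fewBetween {ι E : Type*} (f : E → ℝ) (c : ℝ) (α : ℕ) (k : ι) : Set (ι → E) :=
  {v | f (v k) < c ∧ Set.ncard {s : ι | s ≠ k ∧ f (v k) ≤ f (v s) ∧ f (v s) < c} < α}

section

variable {ι E : Type*} [Fintype ι] {f : E → ℝ}

theorem card_fewBetween_le (c : ℝ) (α : ℕ) (v : ι → E) :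
    (Finset.univ.filter fun k => v ∈ fewBetween f c α k).card ≤ α := by
  set K := Finset.univ.filter fun k => v ∈ fewBetween f c α k
  rcases K.eq_empty_or_nonempty with h | h
  · simp [h]
  obtain ⟨k, hk, hmin⟩ := K.exists_min_image (fun k => f (v k)) h
  have hk' : v ∈ fewBetween f c α k := (Finset.mem_filter.1 hk).2
  have hsub : ((K.erase k : Finset ι) : Set ι) ⊆
      {s : ι | s ≠ k ∧ f (v k) ≤ f (v s) ∧ f (v s) < c} := by
    intro s hs
    obtain ⟨hsk, hsK⟩ := Finset.mem_erase.1 (Finset.mem_coe.1 hs)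
    exact ⟨hsk, hmin s hsK, (Finset.mem_filter.1 hsK).2.1⟩
  have hle := Set.ncard_le_ncard hsub (Set.toFinite _)
  rw [Set.ncard_coe_finset, Finset.card_erase_of_mem hk] at hle
  have := hk'.2
  omega

variable [MeasurableSpace E]

theorem measurableSet_fewBetween (hf : Measurable f) (c : ℝ) (α : ℕ) (k : ι) :
    MeasurableSet (fewBetween f c α k) := by
  have hv : ∀ s : ι, Measurable fun v : ι → E => f (v s) :=
    fun s => hf.comp (measurable_pi_apply s)
  refine (measurableSet_lt (hv k) measurable_const).inter ?_
  have hcard : ∀ v : ι → E,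
      Set.ncard {s : ι | s ≠ k ∧ f (v k) ≤ f (v s) ∧ f (v s) < c} =
        ∑ s : ι, if s ≠ k ∧ f (v k) ≤ f (v s) ∧ f (v s) < c then 1 else 0 := by
    intro v
    rw [← Finset.card_filter, ← Set.ncard_coe_finset]
    simp
  suffices hsum : Measurable fun v : ι → E =>
      ∑ s : ι, if s ≠ k ∧ f (v k) ≤ f (v s) ∧ f (v s) < c then 1 else 0 by
    simp only [hcard]
    exact measurableSet_lt hsum measurable_const
  refine Finset.measurable_fun_sum _ fun s _ => ?_
  refine Measurable.ite ?_ measurable_const measurable_const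
  exact (MeasurableSet.const _).inter
    ((measurableSet_le (hv k) (hv s)).inter (measurableSet_lt (hv s) measurable_const))

theorem measure_fewBetween_eq (hf : Measurable f) (D : Measure E) [SigmaFinite D] (c : ℝ) (α : ℕ)
    (k l : ι) :
    Measure.pi (fun _ : ι => D) (fewBetween f c α k) =
      Measure.pi (fun _ : ι => D) (fewBetween f c α l) := by
  have hmp := measurePreserving_piCongrLeft (fun _ : ι => D) (Equiv.swap k l)
  rw [← hmp.measure_preimage (measurableSet_fewBetween hf c α k).nullMeasurableSet]
  congr 1
  ext v
  have happ : ∀ s, MeasurableEquiv.piCongrLeft (fun _ : ι => E) (Equiv.swap k l) v s =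
      v (Equiv.swap k l s) := by
    intro s
    have := Equiv.piCongrLeft_apply_apply (fun _ : ι => E) (Equiv.swap k l) v (Equiv.swap k l s)
    rwa [Equiv.swap_apply_self] at this
  have himage : {s : ι | s ≠ l ∧ f (v l) ≤ f (v s) ∧ f (v s) < c} = Equiv.swap k l ''
      {s : ι | s ≠ k ∧ f (v l) ≤ f (v (Equiv.swap k l s)) ∧ f (v (Equiv.swap k l s)) < c} := by
    rw [Equiv.image_eq_preimage_symm]
    ext s
    simp [Equiv.swap_apply_eq_iff]
  simp only [fewBetween, Set.mem_preimage, Set.mem_ofPred_eq, happ, Equiv.swap_apply_left, himage,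
    Set.ncard_image_of_injective _ (Equiv.swap k l).injective]

theorem measure_fewBetween_le (hf : Measurable f) (D : Measure E) [IsProbabilityMeasure D] (c : ℝ)
    (α : ℕ) (k : ι) :
    Measure.pi (fun _ : ι => D) (fewBetween f c α k) ≤ α / Fintype.card ι := by
  have : Nonempty ι := ⟨k⟩
  rw [ENNReal.le_div_iff_mul_le (Or.inl (by simp)) (Or.inl (by simp))]
  set μ := Measure.pi fun _ : ι => D
  calc μ (fewBetween f c α k) * Fintype.card ι
      = ∑ l : ι, μ (fewBetween f c α l) := by
        rw [Finset.sum_congr rfl fun l _ => measure_fewBetween_eq hf D c α l k]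
        simp [mul_comm, μ]
    _ = ∫⁻ v, ∑ l : ι, (fewBetween f c α l).indicator 1 v ∂μ := by
        rw [lintegral_finsetSum _ fun l _ =>
          measurable_one.indicator (measurableSet_fewBetween hf c α l)]
        exact Finset.sum_congr rfl fun l _ =>
          (lintegral_indicator_one (measurableSet_fewBetween hf c α l)).symm
    _ ≤ ∫⁻ _, α ∂μ := by
        refine lintegral_mono fun v => ?_
        have := card_fewBetween_le (f := f) c α v
        simp only [Set.indicator_apply, Pi.one_apply, Finset.sum_boole]
        exact_mod_cast this
    _ = α := by simp [μ]

end

theorem stmt15 (p : ℕ) (hp : 0 < p)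
    (D : Measure (Fin p → ℝ)) [IsProbabilityMeasure D]
    (astar bstar : Fin p → ℝ) (hab : ∀ i, astar i ≤ bstar i)
    (α : ℕ) (hα : 0 < α)
    (n : ℕ) (hn : 0 < n) :
    Measure.pi (fun _ : Fin n => D)
      {v : Fin n → Fin p → ℝ |
        rect astar bstar (v ⟨n - 1, by omega⟩) = false ∧
        ∀ i : Fin p,
          Set.ncard {s : Fin n | (s : ℕ) < n - 1 ∧
            ((v ⟨n - 1, by omega⟩ i ≤ v s i ∧ v s i < astar i) ∨
              (bstar i < v s i ∧ v s i ≤ v ⟨n - 1, by omega⟩ i))} < α}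
      ≤ 2 * (α : ℝ≥0∞) * (p : ℝ≥0∞) / (n : ℝ≥0∞) := by
  have hlast : ∀ s : Fin n, s ≠ ⟨n - 1, by omega⟩ → (s : ℕ) < n - 1 := by
    intro s hs
    have := s.isLt
    have : (s : ℕ) ≠ n - 1 := fun h => hs (Fin.ext h)
    omega
  set l : Fin n := ⟨n - 1, by omega⟩
  have hsub : {v : Fin n → Fin p → ℝ |
        rect astar bstar (v l) = false ∧
        ∀ i : Fin p,
          Set.ncard {s : Fin n | (s : ℕ) < n - 1 ∧
            ((v l i ≤ v s i ∧ v s i < astar i) ∨ (bstar i < v s i ∧ v s i ≤ v l i))} < α} ⊆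
      ⋃ i : Fin p, (fewBetween (fun x : Fin p → ℝ => x i) (astar i) α l ∪
        fewBetween (fun x : Fin p → ℝ => -x i) (-bstar i) α l) := by
    rintro v ⟨hrect, hcard⟩
    have hout : ¬ ∀ i, astar i ≤ v l i ∧ v l i ≤ bstar i := by
      intro h
      simp [rect, h] at hrect
    obtain ⟨i, hi⟩ := not_forall.1 hout
    refine Set.mem_iUnion.2 ⟨i, ?_⟩
    rcases not_and_or.1 hi with hi | hi
    · refine Or.inl ⟨not_le.1 hi,
        (Set.ncard_le_ncard ?_ (Set.toFinite _)).trans_lt (hcard i)⟩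
      rintro s ⟨hs, h⟩
      exact ⟨hlast s hs, Or.inl h⟩
    · refine Or.inr ⟨neg_lt_neg (not_le.1 hi),
        (Set.ncard_le_ncard ?_ (Set.toFinite _)).trans_lt (hcard i)⟩
      rintro s ⟨hs, h⟩
      exact ⟨hlast s hs, Or.inr ⟨neg_lt_neg_iff.1 h.2, neg_le_neg_iff.1 h.1⟩⟩
  calc _ ≤ _ := measure_mono hsub
    _ ≤ ∑ i : Fin p, _ := measure_iUnion_fintype_le _ _
    _ ≤ ∑ _i : Fin p, ((α : ℝ≥0∞) / n + (α : ℝ≥0∞) / n) := by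
        refine Finset.sum_le_sum fun i _ => (measure_union_le _ _).trans (add_le_add ?_ ?_)
        · simpa using measure_fewBetween_le (measurable_pi_apply i) D (astar i) α l
        · simpa using measure_fewBetween_le (f := fun x : Fin p → ℝ => -x i)
            (measurable_pi_apply i).neg D (-bstar i) α l
    _ = 2 * (α : ℝ≥0∞) * (p : ℝ≥0∞) / (n : ℝ≥0∞) := by
        simp only [Finset.sum_const, Finset.card_univ, Fintype.card_fin, nsmul_eq_mul,
          div_eq_mul_inv]
        ring

end Stmt15
end

section
/- Let F = {1_{x ≤ a} : a ∈ [0,1]} be the threshold class on [0,1] with reference function f ≡ 0 (the all-zeros function, corresponding to the threshold a = 0 interpreted so that f(x) = 0 for all x). For every realizable labeled data set S and every point x̂ in the disagreement region of F restricted to S, at most one point of S — namely the largest positively labeled point of S — can belong to Γ(S, F^{x̂→0}, f); hence |Γ(S, F^{x̂→0}, f)| ≤ 1. -/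
/-!
STATEMENT 16: For the threshold class `F = {1_{x ≤ a} : a ∈ [0,1]}` on `[0,1]`
with the all-zeros reference function `f ≡ 0`, for every realizable labeled data
set `S` and every point `x̂` of the disagreement region of `F` restricted to `S`,
at most one point of `S` — namely the largest positively labeled point of `S` —
can belong to `Γ(S, F^{x̂→0}, f)`; hence `|Γ(S, F^{x̂→0}, f)| ≤ 1`.
-/

open scoped Classical

namespace Stmt16

variable {X : Type*}

/-- Disagreement region of a class of hypotheses. -/
def DIS (G : Set (X → Bool)) : Set X :=
  {x | ∃ g ∈ G, ∃ h ∈ G, g x ≠ h x}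

/-- The common label of all hypotheses of `G` at `x` (when all agree). -/
noncomputable def agreedLabel (G : Set (X → Bool)) (x : X) : Bool :=
  if ∀ h ∈ G, h x = true then true else false

/-- `F` shatters the finite set `s`. -/
def ShattersFinset (F : Set (X → Bool)) (s : Finset X) : Prop :=
  ∀ y : X → Bool, ∃ h ∈ F, ∀ x ∈ s, h x = y x

/-- `VCdim(F) = d`: some set of size `d` is shattered and no set of size `d+1` is. -/
def VCdimEq (F : Set (X → Bool)) (d : ℕ) : Prop :=
  (∃ s : Finset X, s.card = d ∧ ShattersFinset F s) ∧
    ∀ s : Finset X, s.card = d + 1 → ¬ShattersFinset F s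

/-- Restriction of a class to a set of labeled examples (the consistent hypotheses). -/
def restrictC (F : Set (X → Bool)) (S : Set (X × Bool)) : Set (X → Bool) :=
  {h | h ∈ F ∧ ∀ p ∈ S, h p.1 = p.2}

/-- Restriction of a class to one additional labeled example: `G^{x→b}`. -/
def restrictPoint (G : Set (X → Bool)) (x : X) (b : Bool) : Set (X → Bool) :=
  {h | h ∈ G ∧ h x = b}

/-- The labeled examples of `S` disagreeing with the reference function `f`. -/
def Sref (f : X → Bool) (S : Set (X × Bool)) : Set (X × Bool) :=
  {p ∈ S | f p.1 ≠ p.2}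

/-- The leave-one-out disagreement estimate `Γ(S, F, f)`. -/
def Gamma (S : Set (X × Bool)) (F : Set (X → Bool)) (f : X → Bool) : Set X :=
  {x | ∃ y, (x, y) ∈ S ∧ x ∈ DIS (restrictC F (Sref f S \ {(x, y)}))}
/-- The threshold hypothesis `1_{x ≤ a}`. -/
noncomputable def thresh (a : ℝ) : ℝ → Bool := fun x => if x ≤ a then true else false

/-- The class of thresholds on `[0,1]`. -/
noncomputable def thresholdClass : Set (ℝ → Bool) :=
  {h | ∃ a ∈ Set.Icc (0 : ℝ) 1, h = thresh a}

/-- The all-zeros reference function. -/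
def zeroFun : ℝ → Bool := fun _ => false

theorem thresh_eq_true_iff {a x : ℝ} : thresh a x = true ↔ x ≤ a := by
  simp [thresh]

theorem thresh_eq_false_iff {a x : ℝ} : thresh a x = false ↔ a < x := by
  simp [thresh]

/-- A point of the disagreement region is labeled `1` by some hypothesis and `0` by another. -/
theorem exists_true_false_of_mem_DIS {G : Set (X → Bool)} {x : X} (hx : x ∈ DIS G) :
    (∃ g ∈ G, g x = true) ∧ ∃ h ∈ G, h x = false := by
  obtain ⟨g, hg, h, hh, hne⟩ := hx
  cases hgx : g x <;> cases hhx : h x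
  · simp_all
  · exact ⟨⟨h, hh, hhx⟩, g, hg, hgx⟩
  · exact ⟨⟨g, hg, hgx⟩, h, hh, hhx⟩
  · simp_all

/-- A point of the leave-one-out estimate for `F^{x̂→0}` is the largest positive point of `S`. -/
theorem isLargestPositive_of_mem_Gamma {S : Set (ℝ × Bool)} {xh z : ℝ}
    (hxhDIS : xh ∈ DIS (restrictC thresholdClass S))
    (hz : z ∈ Gamma S (restrictPoint thresholdClass xh false) zeroFun) :
    (z, true) ∈ S ∧ ∀ q ∈ S, q.2 = true → q.1 ≤ z := by
  obtain ⟨y, hzS, hzDIS⟩ := hz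
  obtain ⟨⟨_, ⟨⟨⟨a, -, rfl⟩, ha⟩, -⟩, haz⟩, _, ⟨⟨⟨b, -, rfl⟩, -⟩, hb⟩, hbz⟩ :=
    exists_true_false_of_mem_DIS hzDIS
  rw [thresh_eq_false_iff] at ha hbz
  rw [thresh_eq_true_iff] at haz
  cases y with
  | false =>
    obtain ⟨⟨_, ⟨⟨c, -, rfl⟩, hc⟩, hcx⟩, -⟩ := exists_true_false_of_mem_DIS hxhDIS
    have hcz := thresh_eq_false_iff.1 (hc _ hzS)
    rw [thresh_eq_true_iff] at hcx
    linarith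
  | true =>
    refine ⟨hzS, ?_⟩
    rintro ⟨q, _⟩ hq rfl
    by_contra! hlt
    have hqb := hb (q, true) ⟨⟨hq, by simp [zeroFun]⟩, by simpa using hlt.ne'⟩
    rw [thresh_eq_true_iff] at hqb
    linarith

theorem stmt16
    (astar : ℝ) (hastar : astar ∈ Set.Icc (0 : ℝ) 1)
    (S : Finset (ℝ × Bool)) (hS : ∀ p ∈ S, p.2 = thresh astar p.1)
    (hSdom : ∀ p ∈ S, p.1 ∈ Set.Icc (0 : ℝ) 1)
    (xh : ℝ) (hxh : xh ∈ Set.Icc (0 : ℝ) 1)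
    (hxhDIS : xh ∈ DIS (restrictC thresholdClass (↑S))) :
    (∀ z ∈ Gamma (↑S) (restrictPoint thresholdClass xh false) zeroFun,
      (z, true) ∈ S ∧ ∀ q ∈ S, q.2 = true → q.1 ≤ z) ∧
    (Gamma (↑S) (restrictPoint thresholdClass xh false) zeroFun).ncard ≤ 1 := by
  have hlargest := fun z hz => isLargestPositive_of_mem_Gamma (z := z) hxhDIS hz
  have hsub : (Gamma (↑S) (restrictPoint thresholdClass xh false) zeroFun).Subsingleton :=
    fun z hz w hw => le_antisymm
      ((hlargest w hw).2 _ (hlargest z hz).1 rfl) ((hlargest z hz).2 _ (hlargest w hw).1 rfl)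
  exact ⟨hlargest, (Set.ncard_le_one hsub.finite).2 fun z hz w hw => hsub hz hw⟩

end Stmt16
end
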